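/- Under the linear panel data model with heterogeneous (random) coefficients, the instrument setup, Assumptions 1, 2 and 3, and the compact support regularity, suppose additionally there exists λ_min > 0 such that the smallest eigenvalue of R'R is strictly greater than 1/λ_min almost surely. Define U_V = inf over λ ≥ λ_min and μ ∈ ℝ^L of E[ max_{b ∈ ℬ} { μ'SY + (λ R'Y − R'S'μ)'b − b'(λ R'R − e₀)b } ]. Then E(B'e₀B) ≤ U_V. -/

import Mathlib

open MeasureTheory Matrix

noncomputable section

/-- A continuous function of a measurable variable that almost surely lies in a compact set is
integrable. -/
theorem integrable_comp_of_ae_mem_isCompact {Ω E : Type*} [MeasurableSpace Ω]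
    {μ : Measure Ω} [IsFiniteMeasure μ] [TopologicalSpace E] [MeasurableSpace E]
    [OpensMeasurableSpace E] {G : E → ℝ} (hG : Continuous G) {W : Ω → E} (hW : Measurable W)
    {D : Set E} (hD : IsCompact D) (hWD : ∀ᵐ ω ∂μ, W ω ∈ D) :
    Integrable (fun ω => G (W ω)) μ := by
  obtain ⟨C, hC⟩ := hD.exists_bound_of_continuousOn hG.continuousOn
  refine Integrable.of_bound (hG.measurable.comp hW).aestronglyMeasurable C ?_
  filter_upwards [hWD] with ω hω using hC _ hω

/-- The supremum over a compact set of a jointly continuous function of a parameter and of a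
measurable variable that almost surely lies in a compact set is integrable. -/
theorem integrable_iSup_of_ae_mem_isCompact {Ω E F : Type*} [MeasurableSpace Ω]
    {μ : Measure Ω} [IsFiniteMeasure μ] [TopologicalSpace E] [MeasurableSpace E]
    [OpensMeasurableSpace E] [TopologicalSpace F] [SecondCountableTopology F]
    {G : E × F → ℝ} (hG : Continuous G) {V : Ω → E} (hV : Measurable V)
    {D : Set E} (hD : IsCompact D) (hVD : ∀ᵐ ω ∂μ, V ω ∈ D)
    {K : Set F} (hK : IsCompact K) (hKne : K.Nonempty) :
    Integrable (fun ω => ⨆ b : K, G (V ω, b)) μ := by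
  have : Nonempty K := hKne.to_subtype
  obtain ⟨C, hC⟩ := (hD.prod hK).exists_bound_of_continuousOn hG.continuousOn
  have hmeas : Measurable fun ω => ⨆ b : K, G (V ω, b) := by
    obtain ⟨s, hs, hsd⟩ := TopologicalSpace.exists_countable_dense K
    have : Countable s := hs
    have heq : (fun ω => ⨆ b : K, G (V ω, b)) = fun ω => ⨆ b : s, G (V ω, (b : K)) := by
      funext ω
      exact (hsd.ciSup' (f := fun b : K => G (V ω, b)) (by fun_prop)).symm
    rw [heq]
    refine Measurable.iSup fun b => ?_
    have hb : Continuous fun v => G (v, (b : K)) := by fun_prop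
    exact hb.measurable.comp hV
  refine Integrable.of_bound hmeas.aestronglyMeasurable C ?_
  filter_upwards [hVD] with ω hω
  have hb : ∀ b : K, |G (V ω, b)| ≤ C := fun b => hC (V ω, b) ⟨hω, b.2⟩
  rw [Real.norm_eq_abs, abs_le]
  let b₀ : K := Classical.arbitrary K
  refine ⟨(abs_le.1 (hb b₀)).1.trans (le_ciSup (f := fun b : K => G (V ω, b)) ?_ b₀),
    ciSup_le fun b => (abs_le.1 (hb b)).2⟩
  exact ⟨C, by rintro _ ⟨b, rfl⟩; exact (abs_le.1 (hb b)).2⟩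

/-- A variable with vanishing conditional expectation is orthogonal to the conditioning
variables. -/
theorem integral_mul_eq_zero_of_condExp_eq_zero {Ω : Type*} {m m₀ : MeasurableSpace Ω}
    {μ : Measure Ω} [IsFiniteMeasure μ] (hm : m ≤ m₀) {f g : Ω → ℝ}
    (hf : StronglyMeasurable[m] f) (hfg : Integrable (fun ω => f ω * g ω) μ)
    (hg : Integrable g μ) (h0 : μ[g|m] =ᵐ[μ] 0) :
    ∫ ω, f ω * g ω ∂μ = 0 := by
  have h1 := condExp_mul_of_stronglyMeasurable_left hf hfg hg
  have h2 : μ[f * g|m] =ᵐ[μ] 0 := by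
    filter_upwards [h1, h0] with ω hω hω0
    simp [hω, hω0]
  change ∫ ω, (f * g) ω ∂μ = 0
  rw [← integral_condExp hm, integral_congr_ae h2]
  simp

/-- The dual objective evaluated at `b` splits into the moment functions weighted by the
multipliers and the quadratic form of interest. -/
theorem dual_objective_eq {τ ι κ : Type*} [Fintype τ] [Fintype ι] [Fintype κ]
    (y : τ → ℝ) (R : Matrix τ ι ℝ) (S : Matrix κ τ ℝ) (e : Matrix ι ι ℝ) (b : ι → ℝ)
    (lam : ℝ) (mu : κ → ℝ) :
    mu ⬝ᵥ (S *ᵥ y) + (lam • (Rᵀ *ᵥ y) - Rᵀ *ᵥ (Sᵀ *ᵥ mu)) ⬝ᵥ b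
        - b ⬝ᵥ ((lam • (Rᵀ * R) - e) *ᵥ b)
      = mu ⬝ᵥ (S *ᵥ (y - R *ᵥ b)) + lam * ((R *ᵥ b) ⬝ᵥ (y - R *ᵥ b)) + b ⬝ᵥ (e *ᵥ b) := by
  have h1 : (Rᵀ *ᵥ y) ⬝ᵥ b = (R *ᵥ b) ⬝ᵥ y := by
    rw [mulVec_transpose, ← dotProduct_mulVec, dotProduct_comm]
  have h2 : (Rᵀ *ᵥ (Sᵀ *ᵥ mu)) ⬝ᵥ b = mu ⬝ᵥ (S *ᵥ (R *ᵥ b)) := by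
    rw [mulVec_transpose, mulVec_transpose, ← dotProduct_mulVec, ← dotProduct_mulVec]
  have h3 : b ⬝ᵥ ((Rᵀ * R) *ᵥ b) = (R *ᵥ b) ⬝ᵥ (R *ᵥ b) := by
    rw [← mulVec_mulVec, dotProduct_mulVec, vecMul_transpose]
  simp only [sub_dotProduct, smul_dotProduct, sub_mulVec, smul_mulVec, dotProduct_sub,
    dotProduct_smul, mulVec_sub, smul_eq_mul, h1, h2, h3]
  ring

/-- **Upper bound for the second moment of a random coefficient (Proposition 7).**
Under the dynamic random coefficient model with instruments, compact support, and the
eigenvalue condition that the smallest eigenvalue of `R'R` exceeds `1/λ_min` a.s.,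
`U_V = inf_{λ≥λ_min, μ'} E[max_{b∈ℬ} {μ''SY + (λR'Y − R'S'μ'')'b − b'(λR'R − e₀)b}]`
is an upper bound for `E(B'e₀B)`. -/
theorem second_moment_upper_bound
    {T q p : ℕ} (hT : 1 ≤ T) (hqp : 1 ≤ q + p)
    {Ω : Type*} [MeasurableSpace Ω] (μ : Measure Ω) [IsProbabilityMeasure μ]
    (Z : Fin T → Ω → Fin q → ℝ) (X : Fin T → Ω → Fin p → ℝ)
    (Y : Ω → Fin T → ℝ) (B : Ω → Fin (q + p) → ℝ)
    (hZ : ∀ t, Measurable (Z t)) (hX : ∀ t, Measurable (X t))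
    (hY : Measurable Y) (hB : Measurable B)
    (R : Ω → Matrix (Fin T) (Fin (q + p)) ℝ)
    (hR : ∀ ω t, R ω t = Fin.append (Z t ω) (X t ω))
    -- Assumption 1 (sequential exogeneity)
    (hεint : ∀ t : Fin T, Integrable (fun ω => Y ω t - R ω t ⬝ᵥ B ω) μ)
    (hA1 : ∀ t : Fin T,
      μ[(fun ω => Y ω t - R ω t ⬝ᵥ B ω)|
        MeasurableSpace.comap
          (fun ω => (B ω, fun u : Fin T => Z u ω, fun u : {u : Fin T // u ≤ t} => X u.1 ω))
          inferInstance] =ᵐ[μ] 0)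
    -- Assumption 2 (no multicollinearity)
    (hA2 : ∀ᵐ ω ∂μ, ((R ω)ᵀ * R ω).PosDef)
    -- instrument setup
    (L : Fin T → ℕ) (St : (t : Fin T) → Ω → Fin (L t) → ℝ)
    (hSt : ∀ t, Measurable (St t))
    (S : Ω → Matrix ((t : Fin T) × Fin (L t)) (Fin T) ℝ)
    (hSdef : ∀ ω (pr : (t : Fin T) × Fin (L t)) (u : Fin T),
      S ω pr u = if u = pr.1 then St pr.1 ω pr.2 else 0)
    (hSεint : ∀ (t : Fin T) (i : Fin (L t)),
      Integrable (fun ω => St t ω i * (Y ω t - R ω t ⬝ᵥ B ω)) μ)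
    (hSε : ∀ (t : Fin T) (i : Fin (L t)),
      ∫ ω, St t ω i * (Y ω t - R ω t ⬝ᵥ B ω) ∂μ = 0)
    -- Assumption 3
    (hA3 : ∀ a : (t : Fin T) → Fin (L t) → ℝ, a ≠ 0 →
      0 < μ {ω | ∑ t, (St t ω ⬝ᵥ a t) • R ω t ≠ 0})
    -- compact support regularity
    (Bset : Set (Fin (q + p) → ℝ)) (hBcomp : IsCompact Bset)
    (hBsupp : ∀ᵐ ω ∂μ, B ω ∈ Bset)
    (c : ℝ)
    (hbd : ∀ᵐ ω ∂μ, (∀ t, |Y ω t| ≤ c) ∧ (∀ t j, |R ω t j| ≤ c) ∧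
      (∀ (pr : (t : Fin T) × Fin (L t)) (u : Fin T), |S ω pr u| ≤ c))
    -- e₀ : diagonal matrix with a single unit diagonal entry
    (j0 : Fin (q + p))
    -- Assumption 5: smallest eigenvalue of R'R strictly above 1/λ_min a.s.
    (lamMin : ℝ) (hlamMin : 0 < lamMin)
    (heig : ∀ᵐ ω ∂μ, ∀ x : Fin (q + p) → ℝ, x ≠ 0 →
      (1 / lamMin) * (x ⬝ᵥ x) < x ⬝ᵥ (((R ω)ᵀ * R ω) *ᵥ x)) :
    ∫ ω, B ω ⬝ᵥ (Matrix.diagonal (Pi.single j0 (1 : ℝ)) *ᵥ B ω) ∂μ ≤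
      ⨅ lam : {x : ℝ // lamMin ≤ x}, ⨅ mu : ((t : Fin T) × Fin (L t)) → ℝ,
        ∫ ω, (⨆ b : Bset,
          (mu ⬝ᵥ (S ω *ᵥ Y ω)
            + ((lam.1 • ((R ω)ᵀ *ᵥ Y ω)) - (R ω)ᵀ *ᵥ ((S ω)ᵀ *ᵥ mu)) ⬝ᵥ b.1
            - b.1 ⬝ᵥ ((lam.1 • ((R ω)ᵀ * R ω) -
                Matrix.diagonal (Pi.single j0 (1 : ℝ))) *ᵥ b.1))) ∂μ := by
  have hRm : Measurable (β := Fin T → Fin (q + p) → ℝ) R := by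
    refine measurable_pi_iff.2 fun t => ?_
    simp_rw [hR]
    refine measurable_pi_iff.2 fun j => ?_
    refine Fin.addCases (fun i => ?_) (fun i => ?_) j
    · simpa using measurable_pi_iff.1 (hZ t) i
    · simpa using measurable_pi_iff.1 (hX t) i
  have hSm : Measurable (β := ((t : Fin T) × Fin (L t)) → Fin T → ℝ) S := by
    refine measurable_pi_iff.2 fun pr => measurable_pi_iff.2 fun u => ?_
    simp_rw [hSdef]
    split_ifs
    · exact (measurable_pi_apply pr.2).comp (hSt pr.1)
    · exact measurable_const
  let V : Ω → (Fin T → ℝ) × (Fin T → Fin (q + p) → ℝ) ×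
      (((t : Fin T) × Fin (L t)) → Fin T → ℝ) := fun ω => (Y ω, R ω, S ω)
  have hV : Measurable V := hY.prodMk (hRm.prodMk hSm)
  let I : Set ℝ := Set.Icc (-c) c
  have hI : IsCompact I := isCompact_Icc
  let D : Set ((Fin T → ℝ) × (Fin T → Fin (q + p) → ℝ) ×
      (((t : Fin T) × Fin (L t)) → Fin T → ℝ)) :=
    (Set.univ.pi fun _ => I) ×ˢ (Set.univ.pi fun _ => Set.univ.pi fun _ => I) ×ˢ
      (Set.univ.pi fun _ => Set.univ.pi fun _ => I)
  have hD : IsCompact D :=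
    (isCompact_univ_pi fun _ => hI).prod
      ((isCompact_univ_pi fun _ => isCompact_univ_pi fun _ => hI).prod
        (isCompact_univ_pi fun _ => isCompact_univ_pi fun _ => hI))
  have hVD : ∀ᵐ ω ∂μ, V ω ∈ D := by
    filter_upwards [hbd] with ω ⟨h1, h2, h3⟩
    exact ⟨fun t _ => abs_le.1 (h1 t), fun t _ j _ => abs_le.1 (h2 t j),
      fun pr _ u _ => abs_le.1 (h3 pr u)⟩
  have hVB : ∀ᵐ ω ∂μ, (V ω, B ω) ∈ D ×ˢ Bset := by
    filter_upwards [hVD, hBsupp] with ω h1 h2 using ⟨h1, h2⟩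
  have hint : ∀ {G : _ → ℝ}, Continuous G → Integrable (fun ω => G (V ω, B ω)) μ :=
    fun hG => integrable_comp_of_ae_mem_isCompact hG (hV.prodMk hB) (hD.prod hBcomp) hVB
  have hBne : Bset.Nonempty := let ⟨ω, hω⟩ := hBsupp.exists; ⟨B ω, hω⟩
  have hpred : ∀ t, ∫ ω, (R ω t ⬝ᵥ B ω) * (Y ω t - R ω t ⬝ᵥ B ω) ∂μ = 0 := by
    intro t
    refine integral_mul_eq_zero_of_condExp_eq_zero (Measurable.comap_le ?_) ?_ ?_ (hεint t)
      (hA1 t)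
    · exact hB.prodMk ((measurable_pi_iff.2 hZ).prodMk (measurable_pi_iff.2 fun u => hX u.1))
    · have hh : Measurable fun v : (Fin (q + p) → ℝ) × (Fin T → Fin q → ℝ) ×
          ({u : Fin T // u ≤ t} → Fin p → ℝ) =>
          (Fin.append (v.2.1 t) (v.2.2 ⟨t, le_rfl⟩)) ⬝ᵥ v.1 := by
        simp only [dotProduct, Fin.sum_univ_add, Fin.append_left, Fin.append_right]
        fun_prop
      have hcomp := hh.comp (comap_measurable (fun ω =>
        (B ω, fun u : Fin T => Z u ω, fun u : {u : Fin T // u ≤ t} => X u.1 ω)))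
      simp_rw [hR]
      exact hcomp.stronglyMeasurable
    · exact hint (G := fun w => (w.1.2.1 t ⬝ᵥ w.2) * (w.1.1 t - w.1.2.1 t ⬝ᵥ w.2))
        (by simp only [dotProduct]; fun_prop)
  have hpredint : ∀ t, Integrable (fun ω => (R ω t ⬝ᵥ B ω) * (Y ω t - R ω t ⬝ᵥ B ω)) μ :=
    fun t => hint (G := fun w => (w.1.2.1 t ⬝ᵥ w.2) * (w.1.1 t - w.1.2.1 t ⬝ᵥ w.2))
      (by simp only [dotProduct]; fun_prop)
  have hquad : Integrable
      (fun ω => B ω ⬝ᵥ (Matrix.diagonal (Pi.single j0 (1 : ℝ)) *ᵥ B ω)) μ :=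
    hint (G := fun w => w.2 ⬝ᵥ (Matrix.diagonal (Pi.single j0 (1 : ℝ)) *ᵥ w.2))
      (by fun_prop)
  have : Nonempty {x : ℝ // lamMin ≤ x} := ⟨⟨lamMin, le_rfl⟩⟩
  refine le_ciInf fun lam => le_ciInf fun mu => ?_
  let G : ((Fin T → ℝ) × (Fin T → Fin (q + p) → ℝ) ×
      (((t : Fin T) × Fin (L t)) → Fin T → ℝ)) × (Fin (q + p) → ℝ) → ℝ := fun w =>
    mu ⬝ᵥ (Matrix.of w.1.2.2 *ᵥ w.1.1)
      + ((lam.1 • ((Matrix.of w.1.2.1)ᵀ *ᵥ w.1.1)) -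
          (Matrix.of w.1.2.1)ᵀ *ᵥ ((Matrix.of w.1.2.2)ᵀ *ᵥ mu)) ⬝ᵥ w.2
      - w.2 ⬝ᵥ ((lam.1 • ((Matrix.of w.1.2.1)ᵀ * Matrix.of w.1.2.1) -
          Matrix.diagonal (Pi.single j0 (1 : ℝ))) *ᵥ w.2)
  have hG : Continuous G := by
    have h1 : Continuous fun w : ((Fin T → ℝ) × (Fin T → Fin (q + p) → ℝ) ×
      (((t : Fin T) × Fin (L t)) → Fin T → ℝ)) × (Fin (q + p) → ℝ) => Matrix.of w.1.2.1 :=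
      continuous_fst.snd.fst
    have h2 : Continuous fun w : ((Fin T → ℝ) × (Fin T → Fin (q + p) → ℝ) ×
      (((t : Fin T) × Fin (L t)) → Fin T → ℝ)) × (Fin (q + p) → ℝ) => Matrix.of w.1.2.2 :=
      continuous_fst.snd.snd
    fun_prop
  have hsplit : ∀ ω, G (V ω, B ω) =
      ∑ pr, mu pr * (St pr.1 ω pr.2 * (Y ω pr.1 - R ω pr.1 ⬝ᵥ B ω))
        + lam.1 * ∑ t, (R ω t ⬝ᵥ B ω) * (Y ω t - R ω t ⬝ᵥ B ω)
        + B ω ⬝ᵥ (Matrix.diagonal (Pi.single j0 (1 : ℝ)) *ᵥ B ω) := by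
    intro ω
    refine (dual_objective_eq (Y ω) (R ω) (S ω) _ (B ω) lam.1 mu).trans ?_
    have hS : S ω *ᵥ (Y ω - R ω *ᵥ B ω) =
        fun pr => St pr.1 ω pr.2 * (Y ω pr.1 - R ω pr.1 ⬝ᵥ B ω) := by
      funext pr
      change ∑ u, S ω pr u * (Y ω u - R ω u ⬝ᵥ B ω) = _
      simp [hSdef]
    rw [hS]
    rfl
  have hintS := integrable_finsetSum Finset.univ
    fun (pr : (t : Fin T) × Fin (L t)) _ => (hSεint pr.1 pr.2).const_mul (mu pr)
  have hintR := (integrable_finsetSum Finset.univ fun t _ => hpredint t).const_mul lam.1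
  have hmean : ∫ ω, G (V ω, B ω) ∂μ =
      ∫ ω, B ω ⬝ᵥ (Matrix.diagonal (Pi.single j0 (1 : ℝ)) *ᵥ B ω) ∂μ := by
    simp_rw [hsplit]
    refine (integral_add (hintS.add hintR) hquad).trans ?_
    rw [integral_add' hintS hintR,
      integral_finsetSum _ fun pr _ => (hSεint pr.1 pr.2).const_mul (mu pr),
      integral_const_mul, integral_finsetSum _ fun t _ => hpredint t]
    simp only [integral_const_mul, hSε, hpred]
    simp
  change _ ≤ ∫ ω, (⨆ b : Bset, G (V ω, b)) ∂μ
  clear_value G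
  rw [← hmean]
  refine integral_mono_ae (hint hG)
    (integrable_iSup_of_ae_mem_isCompact hG hV hD hVD hBcomp hBne) ?_
  filter_upwards [hBsupp] with ω hω
  have hbdd := hBcomp.bddAbove_image (f := fun b => G (V ω, b)) (by fun_prop)
  rw [Set.image_eq_range] at hbdd
  exact le_ciSup hbdd ⟨B ω, hω⟩
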